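/- Let D be the center of an A₅⁸(1)-polytope in Pic S₈ (the sum of six distinct lines pairwise intersecting in 1). Then D + 3K is a skew 3-line: there exist three pairwise-disjoint lines l_a, l_b, l_c with D + 3K = l_a + l_b + l_c. Moreover, the three uniquely determined cornered A₃⁸(1)-polytopes contained in the A₅⁸(1)-polytope have all their lines of intersection 0 with l_a, l_b, l_c respectively; equivalently, the three lines K + A/2 associated to the centers A of these three cornered subsets are exactly l_a, l_b, l_c. -/

import Mathlib

/-!
Picard lattice of the degree 1 del Pezzo surface S₈:
Pic S₈ = ℤh ⊕ ℤe₁ ⊕ ⋯ ⊕ ℤe₈ ≅ ℤ⁹, with intersection pairing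
h·h = 1, h·eᵢ = 0, eᵢ·eⱼ = −δᵢⱼ, and canonical class K = −3h + e₁ + ⋯ + e₈.
-/

namespace DelPezzo

/-- The Picard lattice `Pic S₈ ≅ ℤ⁹`; coordinate `0` is the `h`-coordinate and
coordinates `1,…,8` are the `e₁,…,e₈`-coordinates. -/
abbrev Pic : Type := Fin 9 → ℤ

/-- The intersection pairing on `Pic S₈` (signature `(1,-8)`). -/
def inter (x y : Pic) : ℤ := x 0 * y 0 - ∑ i : Fin 8, x i.succ * y i.succ

/-- The canonical class `K = -3h + e₁ + ⋯ + e₈`. -/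
def K : Pic := fun i => if i = 0 then -3 else 1

/-- A line: a class `l` with `l·l = -1` and `l·K = -1`. -/
def IsLine (l : Pic) : Prop := inter l l = -1 ∧ inter l K = -1

/-- A finite set of lines is cornered if some line has intersection `0` with all of them. -/
def IsCornered (T : Finset Pic) : Prop := ∃ m : Pic, IsLine m ∧ ∀ x ∈ T, inter m x = 0

open scoped symmDiff

/-- The intersection pairing as a bilinear form. -/
def interForm : LinearMap.BilinForm ℤ Pic :=
  LinearMap.mk₂ ℤ inter
    (fun x y z => by simp only [inter, Fin.sum_univ_eight, Pi.add_apply]; ring)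
    (fun c x y => by simp only [inter, Fin.sum_univ_eight, Pi.smul_apply, smul_eq_mul]; ring)
    (fun x y z => by simp only [inter, Fin.sum_univ_eight, Pi.add_apply]; ring)
    (fun c x y => by simp only [inter, Fin.sum_univ_eight, Pi.smul_apply, smul_eq_mul]; ring)

lemma interForm_apply (x y : Pic) : interForm x y = inter x y := rfl

lemma inter_comm (x y : Pic) : inter x y = inter y x := by
  simp only [inter, mul_comm]

lemma inter_add_left (x y z : Pic) : inter (x + y) z = inter x z + inter y z := by
  simp only [← interForm_apply, map_add, LinearMap.add_apply]

lemma inter_add_right (x y z : Pic) : inter x (y + z) = inter x y + inter x z := by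
  simp only [← interForm_apply, map_add]

lemma inter_sub_left (x y z : Pic) : inter (x - y) z = inter x z - inter y z := by
  simp only [← interForm_apply, map_sub, LinearMap.sub_apply]

lemma inter_sub_right (x y z : Pic) : inter x (y - z) = inter x y - inter x z := by
  simp only [← interForm_apply, map_sub]

lemma inter_two_smul_left (x y : Pic) : inter (2 • x) y = 2 * inter x y := by
  rw [two_smul, inter_add_left, two_mul]

lemma inter_two_smul_right (x y : Pic) : inter x (2 • y) = 2 * inter x y := by
  rw [two_smul, inter_add_right, two_mul]

lemma inter_sum_left {ι : Type*} (S : Finset ι) (f : ι → Pic) (y : Pic) :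
    inter (∑ i ∈ S, f i) y = ∑ i ∈ S, inter (f i) y := by
  simp only [← interForm_apply, map_sum, LinearMap.sum_apply]

lemma inter_sum_right {ι : Type*} (S : Finset ι) (f : ι → Pic) (y : Pic) :
    inter y (∑ i ∈ S, f i) = ∑ i ∈ S, inter y (f i) := by
  simp only [← interForm_apply, map_sum]

lemma inter_K_K : inter K K = 1 := by decide

/-- The class `K` is characteristic for the intersection pairing. -/
lemma even_inter_self_add_inter_K (x : Pic) : Even (inter x x + inter x K) := by
  have key : inter x x + inter x K =
      x 0 * (x 0 + 1) - 4 * x 0 - ∑ i : Fin 8, x i.succ * (x i.succ + 1) := by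
    simp [inter, K, Fin.succ_ne_zero, mul_add, Finset.sum_add_distrib]
    ring
  rw [key]
  refine ((Int.even_mul_succ_self _).sub ⟨2 * x 0, by ring⟩).sub ?_
  exact Finset.even_sum _ fun i _ => Int.even_mul_succ_self _

/-- A family of pairwise orthogonal roots of the lattice `K^⊥`. -/
structure IsOrthogonalRoots (r : Fin 6 → Pic) : Prop where
  inter_eq : ∀ i j, inter (r i) (r j) = if i = j then -2 else 0
  inter_K : ∀ i, inter (r i) K = 0

/-- The partial sum of `r` over `S` is divisible by two. -/
def IsHalvable (r : Fin 6 → Pic) (S : Finset (Fin 6)) : Prop :=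
  ∃ w : Pic, 2 • w = ∑ i ∈ S, r i

lemma two_smul_injective : Function.Injective fun x : Pic => 2 • x :=
  fun _ _ h => smul_right_injective Pic (two_ne_zero : (2 : ℕ) ≠ 0) h

lemma card_symmDiff_add {α : Type*} [DecidableEq α] (S T : Finset α) :
    (S ∆ T).card + 2 * (S ∩ T).card = S.card + T.card := by
  rw [Finset.symmDiff_def,
    Finset.card_union_of_disjoint (disjoint_sdiff_sdiff : Disjoint (S \ T) (T \ S))]
  have h₁ := Finset.card_sdiff_add_card_inter S T
  have h₂ := Finset.card_sdiff_add_card_inter T S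
  rw [Finset.inter_comm T S] at h₂
  omega

lemma sum_symmDiff_add {α M : Type*} [DecidableEq α] [AddCommMonoid M] (S T : Finset α)
    (f : α → M) :
    ∑ i ∈ S ∆ T, f i + 2 • ∑ i ∈ S ∩ T, f i = ∑ i ∈ S, f i + ∑ i ∈ T, f i := by
  rw [Finset.symmDiff_def,
    Finset.sum_union (disjoint_sdiff_sdiff : Disjoint (S \ T) (T \ S)), two_smul,
    ← Finset.sum_inter_add_sum_sdiff S T f, ← Finset.sum_inter_add_sum_sdiff T S f,
    Finset.inter_comm T S]
  abel

lemma IsHalvable.symmDiff {r : Fin 6 → Pic} {S T : Finset (Fin 6)} (hS : IsHalvable r S)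
    (hT : IsHalvable r T) : IsHalvable r (S ∆ T) := by
  obtain ⟨v, hv⟩ := hS
  obtain ⟨w, hw⟩ := hT
  refine ⟨v + w - ∑ i ∈ S ∩ T, r i, ?_⟩
  rw [smul_sub, smul_add, hv, hw, ← sum_symmDiff_add, add_sub_cancel_right]

namespace IsOrthogonalRoots

variable {r : Fin 6 → Pic} (hr : IsOrthogonalRoots r)
include hr

lemma two_mul_inter_half {S : Finset (Fin 6)} {w : Pic} (hw : 2 • w = ∑ i ∈ S, r i)
    (j : Fin 6) : 2 * inter w (r j) = if j ∈ S then -2 else 0 := by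
  rw [← inter_two_smul_left, hw, inter_sum_left]
  simp [hr.inter_eq]

lemma two_mul_inter_halves {S T : Finset (Fin 6)} {v w : Pic} (hv : 2 • v = ∑ i ∈ S, r i)
    (hw : 2 • w = ∑ i ∈ T, r i) : 2 * inter v w = -(S ∩ T).card := by
  have h : 2 * (2 * inter v w) = 2 * -((S ∩ T).card : ℤ) := by
    rw [← inter_two_smul_right, hw, inter_sum_right, Finset.mul_sum,
      Finset.sum_congr rfl fun j _ => hr.two_mul_inter_half hv j, Finset.sum_ite_mem,
      Finset.sum_const, Finset.inter_comm, nsmul_eq_mul]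
    ring
  omega

lemma inter_half_K {S : Finset (Fin 6)} {w : Pic} (hw : 2 • w = ∑ i ∈ S, r i) :
    inter w K = 0 := by
  have h : 2 * inter w K = 0 := by
    rw [← inter_two_smul_left, hw, inter_sum_left, Finset.sum_eq_zero fun i _ => hr.inter_K i]
  omega

lemma card_eq_of_isHalvable {S : Finset (Fin 6)} (hS : IsHalvable r S) (hne : S.Nonempty) :
    S.card = 4 := by
  obtain ⟨w, hw⟩ := hS
  have h := hr.two_mul_inter_halves hw hw
  obtain ⟨k, hk⟩ := even_inter_self_add_inter_K w
  rw [hr.inter_half_K hw] at hk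
  rw [Finset.inter_self] at h
  have := hne.card_pos
  have := Finset.card_le_univ S
  rw [Fintype.card_fin] at this
  omega

/-- Modulo two the roots span an isotropic subspace, hence one of dimension at most four. -/
lemma exists_isHalvable_pair : ∃ S T : Finset (Fin 6), S.Nonempty ∧ T.Nonempty ∧ S ≠ T ∧
    IsHalvable r S ∧ IsHalvable r T := by
  classical
  let A : Matrix (Fin 9) (Fin 6) (ZMod 2) := Matrix.of fun k i => (r i k : ZMod 2)
  have hA : A.transpose * A = 0 := by
    ext i j
    have h : ((inter (r i) (r j) : ℤ) : ZMod 2) = 0 := by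
      rw [hr.inter_eq]; split_ifs <;> decide
    simp only [inter, Int.cast_sub, Int.cast_mul, Int.cast_sum, CharTwo.sub_eq_add] at h
    rw [Matrix.mul_apply, Fin.sum_univ_succ]
    simpa [A] using h
  have hrank : A.rank ≤ 4 := by
    have h := Matrix.rank_add_rank_le_card_of_mul_eq_zero hA
    rw [Matrix.rank_transpose, Fintype.card_fin] at h
    omega
  have hker : 2 ≤ Module.finrank (ZMod 2) (LinearMap.ker A.mulVecLin) := by
    have h := LinearMap.finrank_range_add_finrank_ker A.mulVecLin
    rw [Module.finrank_fin_fun] at h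
    change A.rank + _ = _ at h
    omega
  have hcard : 2 < Fintype.card (LinearMap.ker A.mulVecLin) := by
    rw [Module.card_eq_pow_finrank (K := ZMod 2), ZMod.card]
    calc 2 < 2 ^ 2 := by norm_num
      _ ≤ _ := Nat.pow_le_pow_right (by norm_num) hker
  let supp : (Fin 6 → ZMod 2) → Finset (Fin 6) := fun c => Finset.univ.filter fun i => c i = 1
  have hsupp : Function.Injective supp := by
    intro c d h
    ext i
    have hi : c i = 1 ↔ d i = 1 := by simpa [supp] using Finset.ext_iff.mp h i
    generalize c i = a at hi ⊢
    generalize d i = b at hi ⊢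
    revert a b
    decide
  have hhalf : ∀ c ∈ LinearMap.ker A.mulVecLin, IsHalvable r (supp c) := by
    intro c hc
    have hdvd : ∀ k, (2 : ℤ) ∣ (∑ i ∈ supp c, r i) k := by
      intro k
      refine (ZMod.intCast_zmod_eq_zero_iff_dvd _ 2).mp ?_
      have h := congrFun (LinearMap.mem_ker.mp hc) k
      rw [Matrix.mulVecLin_apply, Pi.zero_apply, Matrix.mulVec, dotProduct] at h
      rw [← h, Finset.sum_apply, Int.cast_sum, Finset.sum_filter]
      refine Finset.sum_congr rfl fun i _ => ?_
      simp only [A, Matrix.of_apply]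
      generalize c i = a
      generalize (r i k : ZMod 2) = b
      revert a b
      decide
    choose w hw using hdvd
    refine ⟨w, funext fun k => ?_⟩
    rw [hw k, Pi.smul_apply, nsmul_eq_mul, Nat.cast_ofNat]
  have hempty : supp 0 = ∅ := by simp [supp]
  have hone : 1 < (Finset.univ.erase (0 : LinearMap.ker A.mulVecLin)).card := by
    rw [Finset.card_erase_of_mem (Finset.mem_univ _), Finset.card_univ]
    omega
  obtain ⟨c, hc, d, hd, hcd⟩ := Finset.one_lt_card.mp hone
  have hne : ∀ x ∈ Finset.univ.erase (0 : LinearMap.ker A.mulVecLin), (supp x).Nonempty := by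
    intro x hx
    rw [Finset.nonempty_iff_ne_empty, ← hempty]
    exact fun h => Finset.ne_of_mem_erase hx (Subtype.ext (hsupp h))
  exact ⟨supp c, supp d, hne c hc, hne d hd, fun h => hcd (Subtype.ext (hsupp h)),
    hhalf c c.2, hhalf d d.2⟩

lemma eq_or_eq_or_eq_symmDiff {S T U : Finset (Fin 6)} (hS : IsHalvable r S)
    (hT : IsHalvable r T) (hU : IsHalvable r U) (hS₄ : S.card = 4) (hT₄ : T.card = 4)
    (hST₄ : (S ∆ T).card = 4) (hU₄ : U.card = 4) : U = S ∨ U = T ∨ U = S ∆ T := by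
  by_contra! h
  have hne {V : Finset (Fin 6)} (hV : IsHalvable r V) (hUV : U ≠ V) : (U ∆ V).card = 4 :=
    hr.card_eq_of_isHalvable (hU.symmDiff hV) (Finset.symmDiff_nonempty.mpr hUV)
  have h₁ := hne hS h.1
  have h₂ := hne hT h.2.1
  have h₃ := hne (hS.symmDiff hT) h.2.2
  have e₀ := card_symmDiff_add S T
  have e₁ := card_symmDiff_add U S
  have e₂ := card_symmDiff_add U T
  have e₃ := card_symmDiff_add U (S ∆ T)
  have e₄ := card_symmDiff_add (U ∩ S) (U ∩ T)
  have hdist : U ∩ (S ∆ T) = (U ∩ S) ∆ (U ∩ T) := inf_symmDiff_distrib_left U S T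
  have e₅ := Finset.card_union_add_card_inter (U ∩ S) (U ∩ T)
  have e₆ := Finset.card_union_add_card_inter S T
  have huniv : S ∪ T = Finset.univ := by
    rw [← Finset.card_eq_iff_eq_univ, Fintype.card_fin]
    omega
  rw [← Finset.inter_union_distrib_left, huniv, Finset.inter_univ] at e₅
  rw [hdist] at e₃
  omega

end IsOrthogonalRoots

/-- The classes `l i + K` attached to pairwise once-intersecting lines are orthogonal roots. -/
lemma isOrthogonalRoots_add_K {l : Fin 6 → Pic} (hline : ∀ i, IsLine (l i))
    (hint : ∀ i j, i ≠ j → inter (l i) (l j) = 1) :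
    IsOrthogonalRoots fun i => l i + K where
  inter_eq i j := by
    rw [inter_add_left, inter_add_right, inter_add_right, inter_comm K, (hline i).2,
      (hline j).2, inter_K_K]
    split_ifs with h
    · rw [h, (hline j).1]; rfl
    · rw [hint i j h]; rfl
  inter_K i := by rw [inter_add_left, (hline i).2, inter_K_K]; rfl

/-- A class `m` equals `K + A / 2`, with `A` the sum of four lines `l i`, if and only if `m + K`
is half the sum of the corresponding roots `l i + K`. -/
lemma two_smul_eq_iff {l : Fin 6 → Pic} {S : Finset (Fin 6)} (hS : S.card = 4) (m : Pic) :
    2 • m = 2 • K + ∑ i ∈ S, l i ↔ 2 • (m + K) = ∑ i ∈ S, (l i + K) := by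
  rw [Finset.sum_add_distrib, Finset.sum_const, hS, smul_add,
    show 4 • K = 2 • K + 2 • K by rw [← add_smul], ← add_assoc, add_left_inj, add_comm (2 • K)]

lemma IsOrthogonalRoots.isLine_half_sub_K {r : Fin 6 → Pic} (hr : IsOrthogonalRoots r)
    {S : Finset (Fin 6)} (hS : S.card = 4) {w : Pic} (hw : 2 • w = ∑ i ∈ S, r i) :
    IsLine (w - K) := by
  have h := hr.two_mul_inter_halves hw hw
  rw [Finset.inter_self, hS] at h
  have hK := hr.inter_half_K hw
  constructor
  · rw [inter_sub_left, inter_sub_right, inter_sub_right, inter_comm K w, hK, inter_K_K]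
    omega
  · rw [inter_sub_left, hK, inter_K_K]; rfl

lemma IsOrthogonalRoots.inter_half_sub_K {r : Fin 6 → Pic} (hr : IsOrthogonalRoots r)
    {S T : Finset (Fin 6)} (hST : (S ∩ T).card = 2) {v w : Pic} (hv : 2 • v = ∑ i ∈ S, r i)
    (hw : 2 • w = ∑ i ∈ T, r i) : inter (v - K) (w - K) = 0 := by
  have h := hr.two_mul_inter_halves hv hw
  rw [hST] at h
  rw [inter_sub_left, inter_sub_right, inter_sub_right, inter_comm K w, hr.inter_half_K hv,
    hr.inter_half_K hw, inter_K_K]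
  omega

lemma IsLine.ne_of_inter_eq_zero {x y : Pic} (hx : IsLine x) (h : inter x y = 0) : x ≠ y := by
  rintro rfl
  have := hx.1
  omega

theorem center_of_A5_gives_skew_three_line (l : Fin 6 → Pic)
    (hinj : Function.Injective l)
    (hline : ∀ i, IsLine (l i))
    (hint : ∀ i j, i ≠ j → inter (l i) (l j) = 1) :
    ∃ la lb lc : Pic, IsLine la ∧ IsLine lb ∧ IsLine lc ∧
      la ≠ lb ∧ la ≠ lc ∧ lb ≠ lc ∧
      inter la lb = 0 ∧ inter la lc = 0 ∧ inter lb lc = 0 ∧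
      (∑ i, l i) + 3 • K = la + lb + lc ∧
      -- the cornering line of each cornered 4-subset is one of `la, lb, lc` …
      (∀ T : Finset Pic, T ⊆ Finset.image l Finset.univ → T.card = 4 → IsCornered T →
        ∀ m : Pic, 2 • m = 2 • K + ∑ x ∈ T, x → m = la ∨ m = lb ∨ m = lc) ∧
      -- … and each of `la, lb, lc` arises this way, cornering the corresponding subset
      (∀ m : Pic, (m = la ∨ m = lb ∨ m = lc) →
        ∃ T : Finset Pic, T ⊆ Finset.image l Finset.univ ∧ T.card = 4 ∧ IsCornered T ∧
          (∀ x ∈ T, inter m x = 0) ∧ 2 • m = 2 • K + ∑ x ∈ T, x) := by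
  have hr := isOrthogonalRoots_add_K hline hint
  obtain ⟨S, T, hSne, hTne, hST, hS, hT⟩ := hr.exists_isHalvable_pair
  have hV := hS.symmDiff hT
  have hS₄ := hr.card_eq_of_isHalvable hS hSne
  have hT₄ := hr.card_eq_of_isHalvable hT hTne
  have hV₄ := hr.card_eq_of_isHalvable hV (Finset.symmDiff_nonempty.mpr hST)
  have hclass := fun U hU hU₄ =>
    hr.eq_or_eq_or_eq_symmDiff (U := U) hS hT hU hS₄ hT₄ hV₄ hU₄
  have cST := card_symmDiff_add S T
  have cSV := card_symmDiff_add S (S ∆ T)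
  have cTV := card_symmDiff_add T (S ∆ T)
  rw [symmDiff_symmDiff_cancel_left] at cSV
  rw [symmDiff_comm S T, symmDiff_symmDiff_cancel_left, symmDiff_comm T S] at cTV
  have huniv : S ∪ T = Finset.univ := by
    have := Finset.card_union_add_card_inter S T
    rw [← Finset.card_eq_iff_eq_univ, Fintype.card_fin]
    omega
  obtain ⟨a, ha⟩ := hS
  obtain ⟨b, hb⟩ := hT
  obtain ⟨c, hc⟩ := hV
  have la := hr.isLine_half_sub_K hS₄ ha
  have lb := hr.isLine_half_sub_K hT₄ hb
  have lc := hr.isLine_half_sub_K hV₄ hc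
  have hab := hr.inter_half_sub_K (by omega) ha hb
  have hac := hr.inter_half_sub_K (by omega) ha hc
  have hbc := hr.inter_half_sub_K (by omega) hb hc
  have arises : ∀ (U : Finset (Fin 6)) (w : Pic), U.card = 4 → 2 • w = ∑ i ∈ U, (l i + K) →
      ∃ T : Finset Pic, T ⊆ Finset.image l Finset.univ ∧ T.card = 4 ∧ IsCornered T ∧
        (∀ x ∈ T, inter (w - K) x = 0) ∧ 2 • (w - K) = 2 • K + ∑ x ∈ T, x := by
    intro U w hU hw
    have hzero : ∀ x ∈ Finset.image l U, inter (w - K) x = 0 := by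
      intro x hx
      obtain ⟨i, hi, rfl⟩ := Finset.mem_image.mp hx
      have h := hr.two_mul_inter_half hw i
      rw [if_pos hi, inter_add_right, hr.inter_half_K hw] at h
      rw [inter_sub_left, inter_comm K, (hline i).2]
      omega
    refine ⟨Finset.image l U, Finset.image_subset_image (Finset.subset_univ U), ?_,
      ⟨w - K, hr.isLine_half_sub_K hU hw, hzero⟩, hzero, ?_⟩
    · rw [Finset.card_image_of_injective U hinj, hU]
    · rw [Finset.sum_image hinj.injOn, two_smul_eq_iff hU, sub_add_cancel, hw]
  refine ⟨a - K, b - K, c - K, la, lb, lc, la.ne_of_inter_eq_zero hab,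
    la.ne_of_inter_eq_zero hac, lb.ne_of_inter_eq_zero hbc, hab, hac, hbc, ?_, ?_, ?_⟩
  · have hsum : a + b + c = ∑ i, (l i + K) := by
      apply two_smul_injective
      change 2 • (a + b + c) = 2 • ∑ i, (l i + K)
      have h₁ := sum_symmDiff_add S T fun i => l i + K
      have h₂ := Finset.sum_union_inter (s₁ := S) (s₂ := T) (f := fun i => l i + K)
      rw [← huniv, smul_add, smul_add, ha, hb, hc, ← h₂]
      rw [← h₂] at h₁
      have h₃ : ∑ i ∈ S ∆ T, (l i + K) =
          ∑ i ∈ S ∪ T, (l i + K) - ∑ i ∈ S ∩ T, (l i + K) := by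
        rw [eq_sub_iff_add_eq]
        rw [two_smul, ← add_assoc] at h₁
        exact add_right_cancel h₁
      rw [h₃, two_smul]
      abel
    rw [Finset.sum_add_distrib, Finset.sum_const, Finset.card_univ, Fintype.card_fin] at hsum
    rw [show a - K + (b - K) + (c - K) = a + b + c - 3 • K by abel, hsum]
    abel
  · intro X hX hX₄ _ m hm
    obtain ⟨U, -, rfl⟩ := Finset.subset_image_iff.mp hX
    rw [Finset.card_image_of_injective U hinj] at hX₄
    rw [Finset.sum_image hinj.injOn, two_smul_eq_iff hX₄] at hm
    have heq : ∀ {w : Pic}, 2 • w = ∑ i ∈ U, (l i + K) → m = w - K := fun hw =>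
      eq_sub_of_add_eq (two_smul_injective (hm.trans hw.symm))
    rcases hclass U ⟨_, hm⟩ hX₄ with rfl | rfl | rfl
    · exact Or.inl (heq ha)
    · exact Or.inr (Or.inl (heq hb))
    · exact Or.inr (Or.inr (heq hc))
  · rintro m (rfl | rfl | rfl)
    · exact arises S a hS₄ ha
    · exact arises T b hT₄ hb
    · exact arises _ c hV₄ hc

end DelPezzo
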